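/- A module M is n-strongly Gorenstein projective if and only if there exists an exact sequence 0 → M →^{f_n} P_{n−1} →^{f_{n−1}} ⋯ →^{f_1} P₀ →^{f_0} M → 0 with each P_i projective such that the direct sum ⊕_{i=1}^{n} Im(f_i) is 1-strongly Gorenstein projective. -/

import Mathlib

open CategoryTheory DirectSum

universe u

section Defs

variable (R : Type u) [Ring R]

/-- The ℤ-indexed complex `⋯ → P (i+1) → P i → ⋯` is exact, and it is the `n`-periodic
unrolling of an exact sequence `0 → M → P_{n-1} → ⋯ → P_0 → M → 0`; that is, `M` is
(isomorphic to) the syzygy of the complex at every position divisible by `n`. -/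
def IsPeriodicExact (n : ℕ) (M : Type u) [AddCommGroup M] [Module R M]
    (P : ℤ → ModuleCat.{u} R) (d : ∀ i : ℤ, P (i + 1) →ₗ[R] P i) : Prop :=
  (∀ i : ℤ, Function.Exact (d (i + 1)) (d i)) ∧
  ∀ k : ℤ, Nonempty (M ≃ₗ[R] LinearMap.range (d ((n : ℤ) * k)))

/-- The complex stays exact after applying `Hom_R(-, Q)` for every projective `Q`. -/
def IsHomExact (P : ℤ → ModuleCat.{u} R) (d : ∀ i : ℤ, P (i + 1) →ₗ[R] P i) : Prop :=
  ∀ (Q : ModuleCat.{u} R), Module.Projective R Q →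
    ∀ i : ℤ, Function.Exact (fun g : P i →ₗ[R] Q => g.comp (d i))
      (fun g : P (i + 1) →ₗ[R] Q => g.comp (d (i + 1)))

/-- `M` is `n`-strongly Gorenstein projective: there is an exact sequence
`0 → M → P_{n-1} → ⋯ → P_0 → M → 0` with all `P i` projective which stays exact
under `Hom_R(-, Q)` for every projective `Q` (encoded via its periodic unrolling). -/
def IsNSGProjective (n : ℕ) (M : Type u) [AddCommGroup M] [Module R M] : Prop :=
  ∃ (P : ℤ → ModuleCat.{u} R) (d : ∀ i : ℤ, P (i + 1) →ₗ[R] P i),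
    (∀ i, Module.Projective R (P i)) ∧ IsPeriodicExact R n M P d ∧ IsHomExact R P d

/-- `M` is Gorenstein projective: it is a syzygy of a totally acyclic complex of
projectives. -/
def IsGProjective (M : Type u) [AddCommGroup M] [Module R M] : Prop :=
  ∃ (P : ℤ → ModuleCat.{u} R) (d : ∀ i : ℤ, P (i + 1) →ₗ[R] P i),
    (∀ i, Module.Projective R (P i)) ∧ (∀ i : ℤ, Function.Exact (d (i + 1)) (d i)) ∧
    IsHomExact R P d ∧ Nonempty (M ≃ₗ[R] LinearMap.range (d 0))

/-- The projective dimension of `M` is at most `m`. -/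
def projDimLE : ℕ → ModuleCat.{u} R → Prop
  | 0, M => Module.Projective R M
  | m + 1, M => ∃ (F : ModuleCat.{u} R) (f : F →ₗ[R] M), Module.Projective R F ∧
      Function.Surjective f ∧ projDimLE m (ModuleCat.of R (LinearMap.ker f))

end Defs

/-- A short exact sequence `0 → A → F → B → 0` with `F` projective such that maps from `A`
to projectives extend to `F`. -/
def SGLink (R : Type u) [Ring R] (A B : Type u) [AddCommGroup A] [Module R A]
    [AddCommGroup B] [Module R B] : Prop :=
  ∃ (F : ModuleCat.{u} R) (a : A →ₗ[R] F) (p : F →ₗ[R] B), Module.Projective R F ∧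
    Function.Injective a ∧ Function.Surjective p ∧ Function.Exact a p ∧
    ∀ (Q : ModuleCat.{u} R), Module.Projective R Q → ∀ f : A →ₗ[R] Q,
      ∃ g : F →ₗ[R] Q, g.comp a = f

theorem SGLink.congr {R : Type u} [Ring R] {A B A' B' : Type u} [AddCommGroup A] [Module R A]
    [AddCommGroup B] [Module R B] [AddCommGroup A'] [Module R A']
    [AddCommGroup B'] [Module R B'] (h : SGLink R A B) (e : A' ≃ₗ[R] A) (e' : B ≃ₗ[R] B') :
    SGLink R A' B' := by
  obtain ⟨F, a, p, hF, ha, hp, hap, hQ⟩ := h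
  refine ⟨F, a.comp e.toLinearMap, e'.toLinearMap.comp p, hF, ?_, ?_, ?_, ?_⟩
  · exact ha.comp e.injective
  · exact e'.surjective.comp hp
  · intro x
    simp only [LinearMap.comp_apply, LinearEquiv.coe_coe, LinearEquiv.map_eq_zero_iff]
    rw [hap x]
    constructor
    · rintro ⟨y, rfl⟩
      exact ⟨e.symm y, by simp⟩
    · rintro ⟨y, rfl⟩
      exact ⟨e y, by simp⟩
  · intro Q hq f
    obtain ⟨g, hg⟩ := hQ Q hq (f.comp e.symm.toLinearMap)
    refine ⟨g, ?_⟩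
    rw [← LinearMap.comp_assoc, hg]
    ext x
    simp

theorem SGLink.of_complex {R : Type u} [Ring R] {P : ℤ → ModuleCat.{u} R}
    {d : ∀ i : ℤ, P (i + 1) →ₗ[R] P i} (hP : ∀ i, Module.Projective R (P i))
    (hd : ∀ i : ℤ, Function.Exact (d (i + 1)) (d i)) (hH : IsHomExact R P d) (i : ℤ) :
    SGLink R (LinearMap.range (d (i + 1))) (LinearMap.range (d i)) := by
  refine ⟨P (i + 1), (LinearMap.range (d (i + 1))).subtype, (d i).rangeRestrict, hP _,
    Subtype.val_injective, LinearMap.surjective_rangeRestrict _, ?_, ?_⟩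
  · intro x
    rw [← Subtype.coe_inj]
    change d i x = 0 ↔ _
    rw [hd i x]
    simp
  · intro Q hq f
    have h := (hH Q hq (i + 1) (f.comp (d (i + 1)).rangeRestrict)).1 (by
      ext x
      have : (d (i + 1)).rangeRestrict (d (i + 1 + 1) x) = 0 := by
        rw [← Subtype.coe_inj]
        exact (hd (i + 1) _).2 ⟨x, rfl⟩
      simp [this])
    obtain ⟨g, hg⟩ := h
    refine ⟨g, ?_⟩
    ext ⟨_, y, rfl⟩
    exact LinearMap.congr_fun hg y

theorem SGLink.build {R : Type u} [Ring R] (Z : ℤ → ModuleCat.{u} R)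
    (h : ∀ i, SGLink R (Z (i + 1)) (Z i)) :
    ∃ (P : ℤ → ModuleCat.{u} R) (d : ∀ i : ℤ, P (i + 1) →ₗ[R] P i),
      (∀ i, Module.Projective R (P i)) ∧ (∀ i : ℤ, Function.Exact (d (i + 1)) (d i)) ∧
      IsHomExact R P d ∧ ∀ i, Nonempty (Z i ≃ₗ[R] LinearMap.range (d i)) := by
  have h' : ∀ i : ℤ, ∃ (F : ModuleCat.{u} R) (a : Z i →ₗ[R] F), Module.Projective R F ∧
      Function.Injective a ∧ (∀ (Q : ModuleCat.{u} R), Module.Projective R Q →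
      ∀ f : Z i →ₗ[R] Q, ∃ g : F →ₗ[R] Q, g.comp a = f) ∧
      ∀ j, i = j + 1 → ∃ p : F →ₗ[R] Z j, Function.Surjective p ∧ Function.Exact a p := by
    intro i
    obtain ⟨j, rfl⟩ : ∃ j, i = j + 1 := ⟨i - 1, by ring⟩
    obtain ⟨F, a, p, hF, ha, hp, hap, hQ⟩ := h j
    refine ⟨F, a, hF, ha, hQ, ?_⟩
    intro j' hj
    obtain rfl : j = j' := by omega
    exact ⟨p, hp, hap⟩
  choose P a hP ha hQ hp using h'
  choose p hp hap using fun i => hp (i + 1) i rfl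
  refine ⟨P, fun i => (a i).comp (p i), hP, ?_, ?_, ?_⟩
  · intro i x
    simp only [LinearMap.comp_apply]
    rw [map_eq_zero_iff _ (ha i), hap i x]
    constructor
    · rintro ⟨y, rfl⟩
      obtain ⟨z, rfl⟩ := hp (i + 1) y
      exact ⟨z, rfl⟩
    · rintro ⟨y, rfl⟩
      exact ⟨_, rfl⟩
  · intro Q hq i g
    constructor
    · intro hg
      have hg' : ∀ z, g (a (i + 1) z) = 0 := by
        intro z
        obtain ⟨y, rfl⟩ := hp (i + 1) z
        exact LinearMap.congr_fun hg y
      have hk : LinearMap.ker (p i) ≤ LinearMap.ker g := by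
        intro x hx
        obtain ⟨z, rfl⟩ := (hap i x).1 hx
        exact hg' z
      let e := (p i).quotKerEquivOfSurjective (hp i)
      obtain ⟨k, hk'⟩ := hQ i Q hq (((LinearMap.ker (p i)).liftQ g hk).comp e.symm.toLinearMap)
      refine ⟨k, ?_⟩
      ext x
      have h1 := LinearMap.congr_fun hk' (p i x)
      have h2 : e.symm (p i x) = Submodule.Quotient.mk x := by
        rw [LinearEquiv.symm_apply_eq]
        rfl
      simp only [LinearMap.comp_apply, LinearEquiv.coe_coe, h2] at h1
      exact h1
    · rintro ⟨k, rfl⟩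
      ext x
      have : p i (a (i + 1) (p (i + 1) x)) = 0 := (hap i _).2 ⟨_, rfl⟩
      simp [this]
  · intro i
    refine ⟨(LinearEquiv.ofInjective (a i) (ha i)).trans (LinearEquiv.ofEq _ _ ?_)⟩
    rw [LinearMap.range_comp, LinearMap.range_eq_top.2 (hp i), Submodule.map_top]

theorem SGLink.extend {R : Type u} [Ring R] {A N Z : Type u} [AddCommGroup A] [Module R A]
    [AddCommGroup N] [Module R N] [AddCommGroup Z] [Module R Z] (h : SGLink R A N)
    (s : Z →ₗ[R] N) (r : N →ₗ[R] Z) (hrs : ∀ z, r (s z) = z)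
    {F K : Type u} [AddCommGroup F] [Module R F] [AddCommGroup K] [Module R K]
    [Module.Projective R F] (i : K →ₗ[R] F) (p : F →ₗ[R] Z) (hi : Function.Injective i)
    (hp : Function.Surjective p) (hip : Function.Exact i p)
    (Q : ModuleCat.{u} R) (hq : Module.Projective R Q) (f : K →ₗ[R] Q) :
    ∃ g : F →ₗ[R] Q, g.comp i = f := by
  obtain ⟨P, a, π, hP, ha, hπ, haπ, hQ⟩ := h
  obtain ⟨u, hu⟩ := Module.projective_lifting_property p (r.comp π) hp
  obtain ⟨v, hv⟩ := Module.projective_lifting_property π (s.comp p) hπ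
  replace hu : ∀ x, p (u x) = r (π x) := fun x => LinearMap.congr_fun hu x
  replace hv : ∀ x, π (v x) = s (p x) := fun x => LinearMap.congr_fun hv x
  let e : K ≃ₗ[R] LinearMap.range i := LinearEquiv.ofInjective i hi
  have he : ∀ y : LinearMap.range i, i (e.symm y) = y := fun y =>
    congrArg Subtype.val (e.apply_symm_apply y)
  have hei : ∀ (x : K) (hx : i x ∈ LinearMap.range i), e.symm ⟨i x, hx⟩ = x := fun x hx =>
    hi (he _)
  have h1 : ∀ x, u (a x) ∈ LinearMap.range i := fun x => by
    apply (hip _).1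
    rw [hu, (haπ _).2 ⟨x, rfl⟩, map_zero]
  have h2 : ∀ x, (LinearMap.id - u.comp v : F →ₗ[R] F) x ∈ LinearMap.range i := fun x => by
    apply (hip _).1
    simp [hu, hv, hrs]
  obtain ⟨g, hg⟩ := hQ Q hq ((f.comp e.symm.toLinearMap).comp ((u.comp a).codRestrict _ h1))
  refine ⟨g.comp v + (f.comp e.symm.toLinearMap).comp
    ((LinearMap.id - u.comp v : F →ₗ[R] F).codRestrict _ h2), ?_⟩
  ext x
  have hvx : π (v (i x)) = 0 := by rw [hv, (hip _).2 ⟨x, rfl⟩, map_zero]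
  obtain ⟨y, hy⟩ := (haπ _).1 hvx
  have hgy := LinearMap.congr_fun hg y
  simp only [LinearMap.comp_apply, LinearEquiv.coe_coe] at hgy
  simp only [LinearMap.comp_apply, LinearEquiv.coe_coe, LinearMap.add_apply]
  rw [← hy, hgy, ← map_add, ← map_add]
  congr 1
  apply hi
  rw [he]
  simp [hy]

theorem SGLink.directSum {R : Type u} [Ring R] {n : ℕ} (A B : Fin n → Type u)
    [∀ i, AddCommGroup (A i)] [∀ i, Module R (A i)] [∀ i, AddCommGroup (B i)]
    [∀ i, Module R (B i)] (h : ∀ i, SGLink R (A i) (B i)) :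
    SGLink R (∀ i, A i) (∀ i, B i) := by
  classical
  choose F a p hF ha hp hap hQ using h
  have hproj : Module.Projective R (∀ i, F i) :=
    Module.Projective.of_equiv (DirectSum.linearEquivFunOnFintype R (Fin n) (fun i => F i))
  refine ⟨ModuleCat.of R (∀ i, F i), LinearMap.pi fun i => (a i).comp (LinearMap.proj i),
    LinearMap.pi fun i => (p i).comp (LinearMap.proj i), hproj, ?_, ?_, ?_, ?_⟩
  · intro x y hxy
    funext i
    exact ha i (congrFun hxy i)
  · intro y
    choose x hx using fun i => hp i (y i)
    exact ⟨x, funext hx⟩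
  · intro x
    constructor
    · intro hx
      choose y hy using fun i => (hap i (x i)).1 (congrFun hx i)
      exact ⟨y, funext hy⟩
    · rintro ⟨y, rfl⟩
      funext i
      exact (hap i _).2 ⟨y i, rfl⟩
  · intro Q hq f
    choose g hg using fun i => hQ i Q hq (f.comp (LinearMap.single R A i))
    refine ⟨∑ i, (g i).comp (LinearMap.proj i), ?_⟩
    refine LinearMap.ext fun x => ?_
    have h1 : ∀ i, g i (a i (x i)) = f (Pi.single i (x i)) := fun i =>
      LinearMap.congr_fun (hg i) (x i)
    have h2 : (∑ i, Pi.single i (x i) : ∀ i, A i) = x := Finset.univ_sum_single x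
    simp only [LinearMap.comp_apply, LinearMap.sum_apply]
    conv_rhs => rw [← h2, map_sum]
    exact Finset.sum_congr rfl fun i _ => h1 i

/-- `M` is `n`-strongly Gorenstein projective iff there is an exact sequence
`0 → M → P_{n-1} → ⋯ → P_0 → M → 0` with all `P i` projective such that the direct sum
of the images (the syzygies) is `1`-strongly Gorenstein projective. -/
theorem nSGProjective_iff_syzygies_oneSGProjective (R : Type u) [Ring R] (n : ℕ)
    (hn : 0 < n) (M : Type u) [AddCommGroup M] [Module R M] :
    IsNSGProjective R n M ↔
      ∃ (P : ℤ → ModuleCat.{u} R) (d : ∀ i : ℤ, P (i + 1) →ₗ[R] P i),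
        (∀ i, Module.Projective R (P i)) ∧ IsPeriodicExact R n M P d ∧
        IsNSGProjective R 1 (⨁ i : Fin n, LinearMap.range (d ((i : ℕ) : ℤ))) := by
  classical
  constructor
  · rintro ⟨P, d, hP, hper, hH⟩
    refine ⟨P, d, hP, hper, ?_⟩
    obtain ⟨hd, hM⟩ := hper
    have hlink : SGLink R (∀ i : Fin n, LinearMap.range (d (((i : ℕ) : ℤ) + 1)))
        (∀ i : Fin n, LinearMap.range (d ((i : ℕ) : ℤ))) :=
      SGLink.directSum _ _ fun i => SGLink.of_complex hP hd hH _
    have : NeZero n := ⟨hn.ne'⟩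
    have hiso : ∀ i : Fin n, Nonempty (LinearMap.range (d (((finRotate n i : Fin n) : ℕ) : ℤ)) ≃ₗ[R]
        LinearMap.range (d (((i : ℕ) : ℤ) + 1))) := by
      intro i
      have h0 : ∀ j k : ℤ, j = k →
          Nonempty (LinearMap.range (d j) ≃ₗ[R] LinearMap.range (d k)) := by
        rintro j k rfl
        exact ⟨LinearEquiv.refl _ _⟩
      obtain ⟨m, rfl⟩ : ∃ m, n = m + 1 := ⟨n - 1, by omega⟩
      by_cases hi : i = Fin.last m
      · subst hi
        obtain ⟨e1⟩ := hM 0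
        obtain ⟨e2⟩ := hM 1
        obtain ⟨e3⟩ := h0 (((finRotate (m + 1) (Fin.last m) : Fin (m + 1)) : ℕ) : ℤ)
          (((m + 1 : ℕ) : ℤ) * 0) (by simp)
        obtain ⟨e4⟩ := h0 (((m + 1 : ℕ) : ℤ) * 1) ((((Fin.last m : Fin (m+1)) : ℕ) : ℤ) + 1)
          (by simp)
        exact ⟨e3.trans (e1.symm.trans (e2.trans e4))⟩
      · apply h0
        rw [coe_finRotate_of_ne_last hi]
        simp
    let e := fun i => (hiso i).some
    let E1 := LinearEquiv.piCongrRight e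
    let E2 := LinearEquiv.piCongrLeft R
      (fun i : Fin n => LinearMap.range (d ((i : ℕ) : ℤ))) (finRotate n)
    let E3 := DirectSum.linearEquivFunOnFintype R (Fin n)
      (fun i : Fin n => LinearMap.range (d ((i : ℕ) : ℤ)))
    have hN : SGLink R (⨁ i : Fin n, LinearMap.range (d ((i : ℕ) : ℤ)))
        (⨁ i : Fin n, LinearMap.range (d ((i : ℕ) : ℤ))) :=
      hlink.congr (E3.trans (E2.symm.trans E1)) E3.symm
    obtain ⟨P', d', h1, h2, h3, h4⟩ := SGLink.build
      (fun _ => ModuleCat.of R (⨁ i : Fin n, LinearMap.range (d ((i : ℕ) : ℤ)))) fun _ => hN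
    exact ⟨P', d', h1, ⟨h2, fun k => h4 _⟩, h3⟩
  · rintro ⟨P, d, hP, ⟨hd, hM⟩, ⟨P', d', hP', ⟨hd', hN⟩, hH'⟩⟩
    have h0 : ∀ j k : ℤ, j = k →
        Nonempty (LinearMap.range (d j) ≃ₗ[R] LinearMap.range (d k)) := by
      rintro j k rfl
      exact ⟨LinearEquiv.refl _ _⟩
    have hl := SGLink.of_complex hP' hd' hH' ((1 : ℕ) * 0)
    obtain ⟨e⟩ := hN 0
    have hl' := hl.congr (LinearEquiv.refl _ _) e.symm
    have hj : ∀ j : ℤ, 0 ≤ j → j < n →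
        SGLink R (LinearMap.range (d (j + 1))) (LinearMap.range (d j)) := by
      intro j hj0 hjn
      have hex : Function.Exact (LinearMap.range (d (j + 1))).subtype (d j).rangeRestrict := by
        intro x
        rw [← Subtype.coe_inj]
        change d j x = 0 ↔ _
        rw [hd j x]
        simp
      refine ⟨P (j + 1), (LinearMap.range (d (j + 1))).subtype, (d j).rangeRestrict, hP _,
        Subtype.val_injective, LinearMap.surjective_rangeRestrict _, hex, ?_⟩
      obtain ⟨t, rfl⟩ := Int.eq_ofNat_of_zero_le hj0
      have htn : t < n := by omega
      have := hP ((t : ℤ) + 1)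
      intro Q hq f
      exact hl'.extend
        (DirectSum.lof R (Fin n) (fun i : Fin n => LinearMap.range (d ((i : ℕ) : ℤ))) ⟨t, htn⟩)
        (DirectSum.component R (Fin n) (fun i : Fin n => LinearMap.range (d ((i : ℕ) : ℤ))) ⟨t, htn⟩)
        (fun z => DirectSum.component.lof_self R _ _) _ _ Subtype.val_injective
        (LinearMap.surjective_rangeRestrict _) hex Q hq f
    have hn' : (0 : ℤ) < n := by exact_mod_cast hn
    obtain ⟨P₁, d₁, h1, h2, h3, h4⟩ := SGLink.build
      (fun i : ℤ => ModuleCat.of R (LinearMap.range (d (i % (n : ℤ))))) (by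
        intro i
        have hnn := Int.emod_nonneg i hn'.ne'
        have hlt := Int.emod_lt_of_pos i hn'
        have key : Nonempty (LinearMap.range (d ((i + 1) % (n : ℤ))) ≃ₗ[R]
            LinearMap.range (d (i % (n : ℤ) + 1))) := by
          by_cases hc : i % (n : ℤ) + 1 = n
          · obtain ⟨e1⟩ := hM 0
            obtain ⟨e2⟩ := hM 1
            obtain ⟨e3⟩ := h0 ((i + 1) % (n : ℤ)) ((n : ℤ) * 0) (by
              rw [← Int.emod_add_emod, hc]; simp)
            obtain ⟨e4⟩ := h0 ((n : ℤ) * 1) (i % (n : ℤ) + 1) (by rw [hc]; simp)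
            exact ⟨e3.trans (e1.symm.trans (e2.trans e4))⟩
          · apply h0
            rw [← Int.emod_add_emod]
            exact Int.emod_eq_of_lt (by omega) (by omega)
        obtain ⟨e⟩ := key
        exact (hj _ hnn hlt).congr e (LinearEquiv.refl _ _))
    refine ⟨P₁, d₁, h1, ⟨h2, fun k => ?_⟩, h3⟩
    obtain ⟨e1⟩ := hM 0
    obtain ⟨e2⟩ := h0 ((n : ℤ) * 0) (((n : ℤ) * k) % (n : ℤ)) (by simp)
    obtain ⟨e3⟩ := h4 ((n : ℤ) * k)
    exact ⟨e1.trans (e2.trans e3)⟩
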